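/- arXiv:1210.6749 — 2 statements merged into one kernel-verified Lean document; each statement's English description precedes it below -/
import Mathlib

section
/- Let p > 1. Then the function f(x) = log(sinh_p(x)/x) / log(cosh_p(x)) is strictly increasing on (0, ∞), with f(x) → 1/(1+p) as x → 0⁺ and f(x) → 1 as x → ∞. In particular, for all x > 0, cosh_p(x)^(1/(1+p)) < sinh_p(x)/x < cosh_p(x), and the exponents 1/(1+p) and 1 are best possible. -/
open Real Set Filter Topology

/-- Generalized inverse sine: `arcsin_p x = ∫₀ˣ (1 - tᵖ)^(-1/p) dt`. -/
noncomputable def arcsinp (p : ℝ) (x : ℝ) : ℝ := ∫ t in (0:ℝ)..x, (1 - t ^ p) ^ (-1 / p)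

/-- Generalized π: `π_p = 2 · arcsin_p 1`. -/
noncomputable def pip (p : ℝ) : ℝ := 2 * arcsinp p 1

/-- Generalized sine: the inverse of `arcsinp p` (as a map from `[0,1]`). -/
noncomputable def sinp (p : ℝ) : ℝ → ℝ := Function.invFunOn (arcsinp p) (Set.Icc 0 1)

/-- Generalized cosine. -/
noncomputable def cosp (p : ℝ) (x : ℝ) : ℝ := (1 - (sinp p x) ^ p) ^ (1 / p)

/-- Generalized tangent. -/
noncomputable def tanp (p : ℝ) (x : ℝ) : ℝ := sinp p x / cosp p x

/-- Generalized inverse hyperbolic sine: `arsinh_p x = ∫₀ˣ (1 + tᵖ)^(-1/p) dt`. -/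
noncomputable def arsinhp (p : ℝ) (x : ℝ) : ℝ := ∫ t in (0:ℝ)..x, (1 + t ^ p) ^ (-1 / p)

/-- Generalized hyperbolic sine: the inverse of `arsinhp p` (as a map from `[0,∞)`). -/
noncomputable def sinhp (p : ℝ) : ℝ → ℝ := Function.invFunOn (arsinhp p) (Set.Ici 0)

/-- Generalized hyperbolic cosine. -/
noncomputable def coshp (p : ℝ) (x : ℝ) : ℝ := (1 + (sinhp p x) ^ p) ^ (1 / p)

/-- Generalized hyperbolic tangent. -/
noncomputable def tanhp (p : ℝ) (x : ℝ) : ℝ := sinhp p x / coshp p x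

open intervalIntegral in
lemma aux_hopital (f g f' g' r : ℝ → ℝ)
    (hf0 : Tendsto f (𝓝[>] 0) (𝓝 0)) (hg0 : Tendsto g (𝓝[>] 0) (𝓝 0))
    (hf : ∀ x > 0, HasDerivAt f (f' x) x) (hg : ∀ x > 0, HasDerivAt g (g' x) x)
    (hgp : ∀ x > 0, 0 < g x)
    (hg' : ∀ x > 0, 0 < g' x) (hr : ∀ x > 0, f' x = r x * g' x)
    (hmono : StrictMonoOn r (Ioi 0)) :
    StrictMonoOn (fun x => f x / g x) (Ioi 0) := by
  have key : ∀ x > 0, f x < r x * g x := by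
    intro x hx
    have hanti : StrictAntiOn (fun y => f y - r x * g y) (Ioc 0 x) := by
      apply strictAntiOn_of_deriv_neg (convex_Ioc 0 x)
      · intro y hy
        exact ((hf y hy.1).sub ((hg y hy.1).const_mul (r x))).continuousAt.continuousWithinAt
      · intro y hy
        rw [interior_Ioc] at hy
        have hder := ((hf y hy.1).sub ((hg y hy.1).const_mul (r x))).deriv
        change deriv (f - fun y => r x * g y) y < 0
        rw [hder, hr y hy.1]
        have h1 := hmono (mem_Ioi.2 hy.1) (mem_Ioi.2 hx) hy.2
        have h2 := hg' y hy.1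
        nlinarith
    have hx2 : 0 < x / 2 := by linarith
    have hlim : Tendsto (fun y => f y - r x * g y) (𝓝[>] 0) (𝓝 0) := by
      simpa using hf0.sub (hg0.const_mul (r x))
    have hle : f (x/2) - r x * g (x/2) ≤ 0 := by
      apply ge_of_tendsto hlim
      filter_upwards [Ioo_mem_nhdsGT hx2] with y hy
      exact hanti.antitoneOn ⟨hy.1, by linarith [hy.2]⟩ ⟨hx2, by linarith⟩ hy.2.le
    have := hanti (a := x/2) (b := x) ⟨hx2, by linarith⟩ ⟨hx, le_refl _⟩ (by linarith)
    simp only at this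
    linarith
  apply strictMonoOn_of_deriv_pos (convex_Ioi 0)
  · intro y hy
    exact ((hf y hy).div (hg y hy) (hgp y hy).ne').continuousAt.continuousWithinAt
  · intro y hy
    rw [interior_Ioi] at hy
    have hy : 0 < y := hy
    have := ((hf y hy).div (hg y hy) (hgp y hy).ne').deriv
    change 0 < deriv (f / g) y
    rw [this, hr y hy]
    have h1 := key y hy
    have h2 := hg' y hy
    have h3 := hgp y hy
    apply div_pos _ (by positivity)
    nlinarith

noncomputable def auxK (p s : ℝ) : ℝ := (1 + s ^ p) ^ (-1 / p)
noncomputable def auxQ (p s : ℝ) : ℝ := s ^ p / (1 + s ^ p)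

lemma auxK_pos (p s : ℝ) (hs : 0 ≤ s) : 0 < auxK p s := by
  have := Real.rpow_nonneg hs p
  unfold auxK; positivity

lemma arsinhp_abs (p x : ℝ) (hx : 0 ≤ x) :
    arsinhp p x = ∫ t in (0:ℝ)..x, (1 + |t| ^ p) ^ (-1 / p) := by
  unfold arsinhp
  apply intervalIntegral.integral_congr
  intro t ht
  rw [uIcc_of_le hx] at ht
  simp only [abs_of_nonneg ht.1]

lemma aux_cont (p : ℝ) (hp : 1 < p) : Continuous (fun t : ℝ => (1 + |t| ^ p) ^ (-1 / p)) := by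
  have h : Continuous (fun t : ℝ => 1 + |t| ^ p) :=
    continuous_const.add (continuous_abs.rpow_const (fun x => Or.inr (by linarith)))
  apply h.rpow_const
  intro x
  left
  have := Real.rpow_nonneg (abs_nonneg x) p
  positivity

lemma aux_contOn (p : ℝ) (hp : 1 < p) : ContinuousOn (arsinhp p) (Ici 0) := by
  have : Continuous (fun x => ∫ t in (0:ℝ)..x, (1 + |t| ^ p) ^ (-1 / p)) :=
    intervalIntegral.continuous_primitive (fun a b => (aux_cont p hp).intervalIntegrable a b) 0
  exact this.continuousOn.congr (fun x hx => arsinhp_abs p x hx)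

lemma arsinhp_zero (p : ℝ) : arsinhp p 0 = 0 := by simp [arsinhp]

lemma arsinhp_deriv (p : ℝ) (hp : 1 < p) (s : ℝ) (hs : 0 < s) :
    HasDerivAt (arsinhp p) (auxK p s) s := by
  have h := (aux_cont p hp).integral_hasStrictDerivAt 0 s |>.hasDerivAt
  simp only [abs_of_pos hs] at h
  apply h.congr_of_eventuallyEq
  filter_upwards [Ioi_mem_nhds hs] with x hx
  exact arsinhp_abs p x (le_of_lt hx)

lemma arsinhp_strictMono (p : ℝ) (hp : 1 < p) : StrictMonoOn (arsinhp p) (Ici 0) := by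
  apply strictMonoOn_of_deriv_pos (convex_Ici 0) (aux_contOn p hp)
  intro x hx
  rw [interior_Ici] at hx
  rw [(arsinhp_deriv p hp x hx).deriv]
  exact auxK_pos p x (le_of_lt hx)

lemma arsinhp_pos (p : ℝ) (hp : 1 < p) (s : ℝ) (hs : 0 < s) : 0 < arsinhp p s := by
  have := arsinhp_strictMono p hp (a := 0) (b := s) (mem_Ici.2 le_rfl) (mem_Ici.2 hs.le) hs
  rwa [arsinhp_zero] at this

lemma arsinhp_tendsto_zero (p : ℝ) (hp : 1 < p) : Tendsto (arsinhp p) (𝓝[>] 0) (𝓝 0) := by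
  have := (aux_contOn p hp) 0 (mem_Ici.2 le_rfl)
  have h2 : Tendsto (arsinhp p) (𝓝[≥] 0) (𝓝 (arsinhp p 0)) := this
  rw [arsinhp_zero] at h2
  exact h2.mono_left (nhdsWithin_mono _ Ioi_subset_Ici_self)

lemma rpow_deriv (p s : ℝ) (hs : 0 < s) : HasDerivAt (fun s : ℝ => s ^ p) (p * s ^ (p-1)) s :=
  Real.hasDerivAt_rpow_const (Or.inl hs.ne')

lemma rpow_split (p s : ℝ) (hs : 0 < s) : s ^ p = s * s ^ (p-1) := by
  rw [Real.rpow_sub_one hs.ne']; field_simp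

lemma auxK_deriv (p : ℝ) (hp : 1 < p) (s : ℝ) (hs : 0 < s) :
    HasDerivAt (auxK p) (- auxK p s * s ^ (p-1) / (1 + s ^ p)) s := by
  have hu : 0 < 1 + s ^ p := by positivity
  have h := ((rpow_deriv p s hs).const_add 1).rpow_const (p := -1/p) (Or.inl hu.ne')
  refine HasDerivAt.congr_deriv h ?_
  unfold auxK
  rw [Real.rpow_sub_one hu.ne']
  field_simp

lemma auxQ_deriv (p : ℝ) (s : ℝ) (hs : 0 < s) :
    HasDerivAt (auxQ p) (p * s ^ (p-1) / (1 + s ^ p)^2) s := by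
  have hu : 0 < 1 + s ^ p := by positivity
  have h := (rpow_deriv p s hs).div ((rpow_deriv p s hs).const_add 1) hu.ne'
  refine HasDerivAt.congr_deriv h ?_
  congr 1; ring

lemma rpow_tendsto_zero (p : ℝ) (hp : 1 < p) :
    Tendsto (fun s : ℝ => s ^ p) (𝓝[>] 0) (𝓝 0) := by
  have := (Real.continuous_rpow_const (q := p) (by linarith)).tendsto 0
  rw [Real.zero_rpow (by linarith)] at this
  exact this.mono_left nhdsWithin_le_nhds

lemma auxK_tendsto (p : ℝ) (hp : 1 < p) : Tendsto (auxK p) (𝓝[>] 0) (𝓝 1) := by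
  have h : Tendsto (fun s : ℝ => 1 + s ^ p) (𝓝[>] 0) (𝓝 1) := by
    simpa using (rpow_tendsto_zero p hp).const_add 1
  have := h.rpow_const (p := -1/p) (Or.inl one_ne_zero)
  rw [Real.one_rpow] at this
  exact this

lemma auxQ_tendsto (p : ℝ) (hp : 1 < p) : Tendsto (auxQ p) (𝓝[>] 0) (𝓝 0) := by
  have h : Tendsto (fun s : ℝ => 1 + s ^ p) (𝓝[>] 0) (𝓝 1) := by
    simpa using (rpow_tendsto_zero p hp).const_add 1
  have h2 := (rpow_tendsto_zero p hp).div h one_ne_zero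
  rw [zero_div] at h2
  exact h2

lemma id_tendsto : Tendsto (fun s : ℝ => s) (𝓝[>] 0) (𝓝 0) := nhdsWithin_le_nhds

lemma auxN2_deriv (p : ℝ) (hp : 1 < p) (s : ℝ) (hs : 0 < s) :
    HasDerivAt (fun s => arsinhp p s - s * auxK p s) (auxK p s * auxQ p s) s := by
  have h := (arsinhp_deriv p hp s hs).sub ((hasDerivAt_id s).mul (auxK_deriv p hp s hs))
  refine HasDerivAt.congr_deriv h ?_
  simp only [auxQ, id]
  rw [rpow_split p s hs]
  ring

lemma auxQ_pos (p s : ℝ) (hs : 0 < s) : 0 < auxQ p s := by unfold auxQ; positivity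

lemma auxN2_tendsto (p : ℝ) (hp : 1 < p) :
    Tendsto (fun s => arsinhp p s - s * auxK p s) (𝓝[>] 0) (𝓝 0) := by
  simpa using (arsinhp_tendsto_zero p hp).sub (id_tendsto.mul (auxK_tendsto p hp))

lemma auxK_lt_one (p : ℝ) (hp : 1 < p) (s : ℝ) (hs : 0 < s) : auxK p s < 1 := by
  unfold auxK
  apply Real.rpow_lt_one_of_one_lt_of_neg
  · have : 0 < s ^ p := by positivity
    linarith
  · apply div_neg_of_neg_of_pos <;> linarith

/-- s K < A -/
lemma aux_lower (p : ℝ) (hp : 1 < p) (s : ℝ) (hs : 0 < s) : s * auxK p s < arsinhp p s := by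
  have hm : StrictMonoOn (fun s => arsinhp p s - s * auxK p s) (Ioi 0) := by
    apply strictMonoOn_of_deriv_pos (convex_Ioi 0)
    · intro y hy
      exact (auxN2_deriv p hp y hy).continuousAt.continuousWithinAt
    · intro y hy
      rw [interior_Ioi] at hy
      rw [(auxN2_deriv p hp y hy).deriv]
      exact mul_pos (auxK_pos p y (le_of_lt hy)) (auxQ_pos p y hy)
  have hx2 : 0 < s / 2 := by linarith
  have hle : 0 ≤ arsinhp p (s/2) - (s/2) * auxK p (s/2) := by
    apply le_of_tendsto (auxN2_tendsto p hp)
    filter_upwards [Ioo_mem_nhdsGT hx2] with y hy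
    exact hm.monotoneOn hy.1 hx2 hy.2.le
  have := hm (a := s/2) (b := s) hx2 hs (by linarith)
  simp only at this
  linarith

lemma aux_upper (p : ℝ) (hp : 1 < p) (s : ℝ) (hs : 0 < s) : arsinhp p s ≤ s := by
  have hm : MonotoneOn (fun s => s - arsinhp p s) (Ici 0) := by
    apply monotoneOn_of_deriv_nonneg (convex_Ici 0)
    · exact continuousOn_id.sub (aux_contOn p hp)
    · intro y hy
      rw [interior_Ici] at hy
      exact ((hasDerivAt_id y).sub (arsinhp_deriv p hp y hy)).differentiableAt.differentiableWithinAt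
    · intro y hy
      rw [interior_Ici] at hy
      have := ((hasDerivAt_id y).sub (arsinhp_deriv p hp y hy)).deriv
      change 0 ≤ deriv (id - arsinhp p) y
      rw [this]
      linarith [auxK_lt_one p hp y hy]
  have := hm (a := 0) (b := s) (mem_Ici.2 le_rfl) (mem_Ici.2 hs.le) hs.le
  simp only [arsinhp_zero] at this
  linarith

lemma aux_ratio_anti (p : ℝ) (hp : 1 < p) : StrictAntiOn (fun s => arsinhp p s / s) (Ioi 0) := by
  have hd : ∀ y > 0, HasDerivAt (fun s => arsinhp p s / s)
      ((auxK p y * y - arsinhp p y * 1) / y^2) y := fun y hy =>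
    (arsinhp_deriv p hp y hy).div (hasDerivAt_id y) hy.ne'
  apply strictAntiOn_of_deriv_neg (convex_Ioi 0)
  · intro y hy
    exact (hd y hy).continuousAt.continuousWithinAt
  · intro y hy
    rw [interior_Ioi] at hy
    have hy : 0 < y := hy
    rw [(hd y hy).deriv]
    apply div_neg_of_neg_of_pos _ (by positivity)
    linarith [aux_lower p hp y hy]

lemma auxKu (p s : ℝ) (hs : 0 < s) : auxK p s * (1 + s^p) = (1 + s^p) ^ (1 - 1/p) := by
  have hu : 0 < 1 + s ^ p := by positivity
  unfold auxK
  rw [← Real.rpow_add_one hu.ne']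
  congr 1; ring

noncomputable def auxR2 (p s : ℝ) : ℝ := 1 / (1 + p * ((arsinhp p s / s) / (auxK p s * (1 + s^p))))

lemma auxR2_mono (p : ℝ) (hp : 1 < p) : StrictMonoOn (auxR2 p) (Ioi 0) := by
  intro a ha b hb hab
  have ha : 0 < a := ha
  have hb : 0 < b := hb
  have h1 := aux_ratio_anti p hp ha hb hab
  simp only at h1
  have h2 : auxK p a * (1 + a^p) ≤ auxK p b * (1 + b^p) := by
    rw [auxKu p a ha, auxKu p b hb]
    have : 1 / p ≤ 1 := by rw [div_le_one (by linarith)]; linarith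
    apply Real.rpow_le_rpow (by positivity) _ (by linarith)
    have := Real.rpow_le_rpow ha.le hab.le (z := p) (by linarith)
    linarith
  have hAa := arsinhp_pos p hp a ha
  have hAb := arsinhp_pos p hp b hb
  have hKa := auxK_pos p a ha.le
  have hKb := auxK_pos p b hb.le
  have h3 : (arsinhp p b / b) / (auxK p b * (1 + b^p)) < (arsinhp p a / a) / (auxK p a * (1 + a^p)) := by
    apply div_lt_div₀ h1 h2 (by positivity) (by positivity)
  unfold auxR2
  apply one_div_lt_one_div_of_lt
  · have : 0 < p := by linarith
    positivity
  · nlinarith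

lemma auxR2_tendsto (p : ℝ) (hp : 1 < p) : Tendsto (auxR2 p) (𝓝[>] 0) (𝓝 (1 / (1 + p))) := by
  have h1 : Tendsto (fun s => arsinhp p s / s) (𝓝[>] 0) (𝓝 1) := by
    apply tendsto_of_tendsto_of_tendsto_of_le_of_le' (auxK_tendsto p hp) tendsto_const_nhds
    · filter_upwards [self_mem_nhdsWithin] with s hs
      have hs : 0 < s := hs
      rw [le_div_iff₀ hs]
      linarith [aux_lower p hp s hs]
    · filter_upwards [self_mem_nhdsWithin] with s hs
      have hs : 0 < s := hs
      rw [div_le_one hs]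
      exact aux_upper p hp s hs
  have h : Tendsto (fun s : ℝ => 1 + s ^ p) (𝓝[>] 0) (𝓝 1) := by
    simpa using (rpow_tendsto_zero p hp).const_add 1
  have h2 := (auxK_tendsto p hp).mul h
  have h3 := ((h1.div h2 (by norm_num)).const_mul p).const_add 1
  have h4 := (tendsto_const_nhds (x := (1:ℝ))).div h3 (by norm_num; linarith)
  simp only [mul_one, div_one] at h4
  exact h4

lemma auxD2_deriv (p : ℝ) (hp : 1 < p) (s : ℝ) (hs : 0 < s) :
    HasDerivAt (fun s => arsinhp p s * auxQ p s)
      (auxK p s * auxQ p s + arsinhp p s * (p * s ^ (p-1) / (1 + s ^ p)^2)) s :=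
  (arsinhp_deriv p hp s hs).mul (auxQ_deriv p s hs)

lemma auxD2'_pos (p : ℝ) (hp : 1 < p) (s : ℝ) (hs : 0 < s) :
    0 < auxK p s * auxQ p s + arsinhp p s * (p * s ^ (p-1) / (1 + s ^ p)^2) := by
  have := auxK_pos p s hs.le
  have := auxQ_pos p s hs
  have := arsinhp_pos p hp s hs
  have : 0 < p := by linarith
  positivity

lemma auxR2_eq (p : ℝ) (hp : 1 < p) (s : ℝ) (hs : 0 < s) :
    auxK p s * auxQ p s = auxR2 p s *
      (auxK p s * auxQ p s + arsinhp p s * (p * s ^ (p-1) / (1 + s ^ p)^2)) := by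
  have hK := auxK_pos p s hs.le
  have hA := arsinhp_pos p hp s hs
  have hp0 : 0 < p := by linarith
  unfold auxR2 auxQ
  rw [rpow_split p s hs]
  have hw : 0 < s ^ (p-1) := by positivity
  generalize s ^ (p-1) = w at *
  generalize auxK p s = K at *
  generalize arsinhp p s = A at *
  field_simp

noncomputable def auxR1 (p s : ℝ) : ℝ := (arsinhp p s - s * auxK p s) / (arsinhp p s * auxQ p s)

lemma auxD2_tendsto (p : ℝ) (hp : 1 < p) :
    Tendsto (fun s => arsinhp p s * auxQ p s) (𝓝[>] 0) (𝓝 0) := by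
  simpa using (arsinhp_tendsto_zero p hp).mul (auxQ_tendsto p hp)

lemma auxR1_mono (p : ℝ) (hp : 1 < p) : StrictMonoOn (auxR1 p) (Ioi 0) :=
  aux_hopital _ _ _ _ (auxR2 p) (auxN2_tendsto p hp) (auxD2_tendsto p hp)
    (auxN2_deriv p hp) (auxD2_deriv p hp)
    (fun s hs => mul_pos (arsinhp_pos p hp s hs) (auxQ_pos p s hs))
    (auxD2'_pos p hp) (auxR2_eq p hp) (auxR2_mono p hp)

lemma aux_lhop_lim (f g f' g' r : ℝ → ℝ) (L : ℝ)
    (hf0 : Tendsto f (𝓝[>] 0) (𝓝 0)) (hg0 : Tendsto g (𝓝[>] 0) (𝓝 0))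
    (hf : ∀ x > 0, HasDerivAt f (f' x) x) (hg : ∀ x > 0, HasDerivAt g (g' x) x)
    (hg' : ∀ x > 0, 0 < g' x) (hr : ∀ x > 0, f' x = r x * g' x)
    (hL : Tendsto r (𝓝[>] 0) (𝓝 L)) :
    Tendsto (fun x => f x / g x) (𝓝[>] 0) (𝓝 L) := by
  have hlim : Tendsto (fun x => f' x / g' x) (𝓝[>] 0) (𝓝 L) := by
    apply hL.congr'
    filter_upwards [self_mem_nhdsWithin] with s hs
    rw [hr s hs, mul_div_cancel_right₀ _ (hg' s hs).ne']
  refine HasDerivAt.lhopital_zero_nhdsGT (f' := f') (g' := g') ?_ ?_ ?_ hf0 hg0 hlim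
  · filter_upwards [self_mem_nhdsWithin] with s hs using hf s hs
  · filter_upwards [self_mem_nhdsWithin] with s hs using hg s hs
  · filter_upwards [self_mem_nhdsWithin] with s hs using (hg' s hs).ne'

lemma auxR1_tendsto (p : ℝ) (hp : 1 < p) : Tendsto (auxR1 p) (𝓝[>] 0) (𝓝 (1 / (1 + p))) :=
  aux_lhop_lim _ _ _ _ (auxR2 p) _ (auxN2_tendsto p hp) (auxD2_tendsto p hp)
    (auxN2_deriv p hp) (auxD2_deriv p hp)
    (auxD2'_pos p hp) (auxR2_eq p hp) (auxR2_tendsto p hp)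

noncomputable def auxC (p s : ℝ) : ℝ := (1 + s ^ p) ^ (1 / p)

lemma auxC_K (p s : ℝ) (hs : 0 ≤ s) : auxC p s * auxK p s = 1 := by
  have hu : 0 < 1 + s ^ p := by have := Real.rpow_nonneg hs p; positivity
  unfold auxC auxK
  rw [← Real.rpow_add hu, show 1/p + -1/p = 0 by ring, Real.rpow_zero]

lemma auxC_log (p s : ℝ) (hs : 0 ≤ s) : Real.log (auxC p s) = 1/p * Real.log (1 + s^p) := by
  have hu : 0 < 1 + s ^ p := by have := Real.rpow_nonneg hs p; positivity
  unfold auxC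
  rw [Real.log_rpow hu]

lemma auxC_one_lt (p : ℝ) (hp : 1 < p) (s : ℝ) (hs : 0 < s) : 1 < auxC p s := by
  unfold auxC
  apply Real.one_lt_rpow
  · have : 0 < s ^ p := by positivity
    linarith
  · have : 0 < p := by linarith
    positivity

lemma auxN1_deriv (p : ℝ) (hp : 1 < p) (s : ℝ) (hs : 0 < s) :
    HasDerivAt (fun s => Real.log (s / arsinhp p s)) (1 / s - auxK p s / arsinhp p s) s := by
  have hA := arsinhp_pos p hp s hs
  have h := ((hasDerivAt_id s).div (arsinhp_deriv p hp s hs) hA.ne').log (div_pos hs hA).ne'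
  refine HasDerivAt.congr_deriv h ?_
  simp only [id, Pi.div_apply]
  field_simp

lemma auxD1_deriv (p : ℝ) (hp : 1 < p) (s : ℝ) (hs : 0 < s) :
    HasDerivAt (fun s => Real.log (auxC p s)) (s ^ (p-1) / (1 + s^p)) s := by
  have hu : 0 < 1 + s ^ p := by positivity
  have h := (((rpow_deriv p s hs).const_add 1).log hu.ne').const_mul (1/p)
  have h2 : HasDerivAt (fun s => 1/p * Real.log (1 + s^p)) (s ^ (p-1) / (1 + s^p)) s := by
    refine HasDerivAt.congr_deriv h ?_
    field_simp
  apply h2.congr_of_eventuallyEq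
  filter_upwards [Ioi_mem_nhds hs] with x hx
  exact auxC_log p x (le_of_lt hx)

lemma auxR1_eq (p : ℝ) (hp : 1 < p) (s : ℝ) (hs : 0 < s) :
    1 / s - auxK p s / arsinhp p s = auxR1 p s * (s ^ (p-1) / (1 + s^p)) := by
  have hA := arsinhp_pos p hp s hs
  unfold auxR1 auxQ
  rw [rpow_split p s hs]
  have hw : 0 < s ^ (p-1) := by positivity
  generalize s ^ (p-1) = w at *
  generalize auxK p s = K at *
  generalize arsinhp p s = A at *
  field_simp

lemma auxN1_tendsto (p : ℝ) (hp : 1 < p) :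
    Tendsto (fun s => Real.log (s / arsinhp p s)) (𝓝[>] 0) (𝓝 0) := by
  have hC : Tendsto (fun s => (auxK p s)⁻¹) (𝓝[>] 0) (𝓝 1) := by
    simpa using (auxK_tendsto p hp).inv₀ one_ne_zero
  have h1 : Tendsto (fun s => s / arsinhp p s) (𝓝[>] 0) (𝓝 1) := by
    apply tendsto_of_tendsto_of_tendsto_of_le_of_le' tendsto_const_nhds hC
    · filter_upwards [self_mem_nhdsWithin] with s hs
      have hs : 0 < s := hs
      rw [le_div_iff₀ (arsinhp_pos p hp s hs)]
      linarith [aux_upper p hp s hs]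
    · filter_upwards [self_mem_nhdsWithin] with s hs
      have hs : 0 < s := hs
      have hK := auxK_pos p s hs.le
      rw [div_le_iff₀ (arsinhp_pos p hp s hs), inv_mul_eq_div, le_div_iff₀ hK]
      exact (aux_lower p hp s hs).le
  simpa using h1.log one_ne_zero

lemma auxD1_tendsto (p : ℝ) (hp : 1 < p) :
    Tendsto (fun s => Real.log (auxC p s)) (𝓝[>] 0) (𝓝 0) := by
  have h : Tendsto (fun s : ℝ => 1 + s ^ p) (𝓝[>] 0) (𝓝 1) := by
    simpa using (rpow_tendsto_zero p hp).const_add 1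
  have := (h.rpow_const (p := 1/p) (Or.inl one_ne_zero)).log (by simp)
  rw [Real.one_rpow, Real.log_one] at this
  exact this

noncomputable def auxG (p s : ℝ) : ℝ := Real.log (s / arsinhp p s) / Real.log (auxC p s)

lemma auxG_mono (p : ℝ) (hp : 1 < p) : StrictMonoOn (auxG p) (Ioi 0) :=
  aux_hopital _ _ _ _ (auxR1 p) (auxN1_tendsto p hp) (auxD1_tendsto p hp)
    (auxN1_deriv p hp) (auxD1_deriv p hp)
    (fun s hs => Real.log_pos (auxC_one_lt p hp s hs))
    (fun s hs => by have : 0 < s := hs; positivity) (auxR1_eq p hp) (auxR1_mono p hp)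

lemma auxG_tendsto_zero (p : ℝ) (hp : 1 < p) : Tendsto (auxG p) (𝓝[>] 0) (𝓝 (1 / (1 + p))) :=
  aux_lhop_lim _ _ _ _ (auxR1 p) _ (auxN1_tendsto p hp) (auxD1_tendsto p hp)
    (auxN1_deriv p hp) (auxD1_deriv p hp)
    (fun s hs => by have : 0 < s := hs; positivity) (auxR1_eq p hp) (auxR1_tendsto p hp)

lemma auxC_ge (p : ℝ) (hp : 1 < p) (s : ℝ) (hs : 0 < s) : s ≤ auxC p s := by
  have hp0 : 0 < p := by linarith
  unfold auxC
  calc s = (s ^ p) ^ (1/p) := by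
        rw [← Real.rpow_mul hs.le, mul_one_div_cancel hp0.ne', Real.rpow_one]
    _ ≤ _ := Real.rpow_le_rpow (by positivity) (by linarith) (by positivity)

lemma auxC_le (p : ℝ) (hp : 1 < p) (s : ℝ) (hs : 0 < s) : auxC p s ≤ 1 + s := by
  have hp0 : 0 < p := by linarith
  unfold auxC
  calc _ ≤ ((1 + s) ^ p) ^ (1/p) := by
        apply Real.rpow_le_rpow (by positivity) _ (by positivity)
        have := Real.add_rpow_le_rpow_add (zero_le_one) hs.le hp.le
        simpa using this
    _ = 1 + s := by
        rw [← Real.rpow_mul (by positivity), mul_one_div_cancel hp0.ne', Real.rpow_one]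

lemma auxK_eq (p s : ℝ) (hs : 0 < s) : auxK p s = 1 / auxC p s := by
  have h := auxC_K p s hs.le
  have hne : auxC p s ≠ 0 := by intro h0; rw [h0] at h; simp at h
  field_simp
  linarith

lemma arsinhp_ge_log (p : ℝ) (hp : 1 < p) (s : ℝ) (hs : 0 ≤ s) : Real.log (1 + s) ≤ arsinhp p s := by
  have hd : ∀ y > 0, HasDerivAt (fun s => arsinhp p s - Real.log (1 + s))
      (auxK p y - 1 / (1 + y)) y := fun y hy =>
    (arsinhp_deriv p hp y hy).sub (((hasDerivAt_id y).const_add 1).log (by simp only [id]; linarith))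
  have hm : MonotoneOn (fun s => arsinhp p s - Real.log (1 + s)) (Ici 0) := by
    apply monotoneOn_of_deriv_nonneg (convex_Ici 0)
    · apply (aux_contOn p hp).sub
      apply ContinuousOn.log (by fun_prop)
      intro x hx
      have : 0 ≤ x := hx
      positivity
    · intro y hy
      rw [interior_Ici] at hy
      exact (hd y hy).differentiableAt.differentiableWithinAt
    · intro y hy
      rw [interior_Ici] at hy
      rw [(hd y hy).deriv, auxK_eq p y hy]
      have := one_div_le_one_div_of_le (by linarith [auxC_one_lt p hp y hy]) (auxC_le p hp y hy)
      linarith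
  have := hm (a := 0) (b := s) (mem_Ici.2 le_rfl) hs hs
  simp only [arsinhp_zero] at this
  simp at this
  linarith

lemma arsinhp_le_log (p : ℝ) (hp : 1 < p) (s : ℝ) (hs : 1 ≤ s) : arsinhp p s ≤ 1 + Real.log s := by
  have hd : ∀ y > 0, HasDerivAt (fun s => Real.log s - arsinhp p s)
      (y⁻¹ - auxK p y) y := fun y hy =>
    (Real.hasDerivAt_log hy.ne').sub (arsinhp_deriv p hp y hy)
  have hm : MonotoneOn (fun s => Real.log s - arsinhp p s) (Ioi 0) := by
    apply monotoneOn_of_deriv_nonneg (convex_Ioi 0)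
    · intro y hy
      exact (hd y hy).continuousAt.continuousWithinAt
    · intro y hy
      rw [interior_Ioi] at hy
      exact (hd y hy).differentiableAt.differentiableWithinAt
    · intro y hy
      rw [interior_Ioi] at hy
      rw [(hd y hy).deriv, auxK_eq p y hy, inv_eq_one_div]
      have := one_div_le_one_div_of_le hy (auxC_ge p hp y hy)
      linarith
  have := hm (a := 1) (b := s) (mem_Ioi.2 one_pos) (mem_Ioi.2 (by linarith)) hs
  have h2 := aux_upper p hp 1 one_pos
  simp at this
  linarith

lemma auxG_lt_one (p : ℝ) (hp : 1 < p) (s : ℝ) (hs : 0 < s) : s / arsinhp p s < auxC p s := by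
  have h := aux_lower p hp s hs
  have hA := arsinhp_pos p hp s hs
  have hC := auxC_one_lt p hp s hs
  rw [auxK_eq p s hs, mul_one_div, div_lt_iff₀ (by linarith)] at h
  rw [div_lt_iff₀ hA]
  linarith

lemma auxC_tendsto_top (p : ℝ) (hp : 1 < p) : Tendsto (auxC p) atTop atTop := by
  apply tendsto_atTop_mono' atTop _ tendsto_id
  filter_upwards [eventually_gt_atTop 0] with s hs
  exact auxC_ge p hp s hs

lemma auxG_tendsto_top (p : ℝ) (hp : 1 < p) : Tendsto (auxG p) atTop (𝓝 1) := by
  have hL : Tendsto (fun s => Real.log (auxC p s)) atTop atTop :=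
    Real.tendsto_log_atTop.comp (auxC_tendsto_top p hp)
  have h0 : Tendsto (fun L : ℝ => 1 - (Real.log 2 / L + (Real.log (1 + L)) / (1 + L) * (1 + 1 / L))) atTop (𝓝 1) := by
    have e1 : Tendsto (fun L : ℝ => Real.log 2 / L) atTop (𝓝 0) :=
      tendsto_const_nhds.div_atTop tendsto_id
    have e2 : Tendsto (fun L : ℝ => 1 / L) atTop (𝓝 0) :=
      tendsto_const_nhds.div_atTop tendsto_id
    have e3 : Tendsto (fun L : ℝ => Real.log L / L) atTop (𝓝 0) := by
      simpa using Real.isLittleO_log_id_atTop.tendsto_div_nhds_zero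
    have e4 : Tendsto (fun L : ℝ => Real.log (1 + L) / (1 + L)) atTop (𝓝 0) :=
      e3.comp (tendsto_atTop_add_const_left _ 1 tendsto_id)
    simpa using (e1.add (e4.mul (e2.const_add 1))).const_sub 1
  apply tendsto_of_tendsto_of_tendsto_of_le_of_le' (h0.comp hL) tendsto_const_nhds
  · filter_upwards [eventually_ge_atTop 1] with s hs
    have hs0 : 0 < s := by linarith
    have hC := auxC_one_lt p hp s hs0
    have hlog := Real.log_pos hC
    have hA := arsinhp_pos p hp s hs0
    have h1 : Real.log (auxC p s) ≤ Real.log 2 + Real.log s := by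
      rw [← Real.log_mul (by norm_num) hs0.ne']
      apply Real.log_le_log (by linarith)
      linarith [auxC_le p hp s hs0]
    have h2 : Real.log (arsinhp p s) ≤ Real.log (1 + Real.log (auxC p s)) := by
      apply Real.log_le_log hA
      have := Real.log_le_log hs0 (auxC_ge p hp s hs0)
      linarith [arsinhp_le_log p hp s hs]
    simp only [Function.comp, auxG]
    rw [Real.log_div hs0.ne' hA.ne', le_div_iff₀ hlog]
    generalize Real.log (auxC p s) = L at *
    have : (1 - (Real.log 2 / L + Real.log (1 + L) / (1 + L) * (1 + 1 / L))) * L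
        = L - Real.log 2 - Real.log (1 + L) := by
      field_simp
      ring
    rw [this]
    linarith
  · filter_upwards [eventually_gt_atTop 0] with s hs
    have hlog := Real.log_pos (auxC_one_lt p hp s hs)
    unfold auxG
    rw [div_le_one hlog]
    exact Real.log_le_log (div_pos hs (arsinhp_pos p hp s hs)) (auxG_lt_one p hp s hs).le

lemma arsinhp_surj (p : ℝ) (hp : 1 < p) (x : ℝ) (hx : 0 ≤ x) : ∃ s ∈ Ici (0:ℝ), arsinhp p s = x := by
  have hle : x ≤ arsinhp p (Real.exp x) := by
    have h := arsinhp_ge_log p hp (Real.exp x) (Real.exp_pos x).le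
    have h2 := Real.log_le_log (Real.exp_pos x) (show Real.exp x ≤ 1 + Real.exp x by linarith)
    rw [Real.log_exp] at h2
    linarith
  have := intermediate_value_Icc (Real.exp_pos x).le
    ((aux_contOn p hp).mono (Icc_subset_Ici_self))
  obtain ⟨s, hs, h⟩ := this ⟨by rw [arsinhp_zero]; exact hx, hle⟩
  exact ⟨s, hs.1, h⟩

lemma sinhp_nonneg (p : ℝ) (hp : 1 < p) (x : ℝ) (hx : 0 ≤ x) : 0 ≤ sinhp p x :=
  Function.invFunOn_mem (arsinhp_surj p hp x hx)

lemma arsinhp_sinhp (p : ℝ) (hp : 1 < p) (x : ℝ) (hx : 0 ≤ x) : arsinhp p (sinhp p x) = x :=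
  Function.invFunOn_eq (arsinhp_surj p hp x hx)

lemma sinhp_pos (p : ℝ) (hp : 1 < p) (x : ℝ) (hx : 0 < x) : 0 < sinhp p x := by
  rcases (sinhp_nonneg p hp x hx.le).lt_or_eq with h | h
  · exact h
  · have := arsinhp_sinhp p hp x hx.le
    rw [← h, arsinhp_zero] at this
    linarith

lemma sinhp_mono (p : ℝ) (hp : 1 < p) : StrictMonoOn (sinhp p) (Ioi 0) := by
  intro a ha b hb hab
  have ha : 0 < a := ha
  have hb : 0 < b := hb
  rw [← (arsinhp_strictMono p hp).lt_iff_lt (sinhp_nonneg p hp a ha.le) (sinhp_nonneg p hp b hb.le),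
    arsinhp_sinhp p hp a ha.le, arsinhp_sinhp p hp b hb.le]
  exact hab

lemma sinhp_tendsto_top (p : ℝ) (hp : 1 < p) : Tendsto (sinhp p) atTop atTop := by
  apply tendsto_atTop_mono' atTop _ tendsto_id
  filter_upwards [eventually_gt_atTop 0] with x hx
  have := aux_upper p hp _ (sinhp_pos p hp x hx)
  rwa [arsinhp_sinhp p hp x hx.le] at this

lemma sinhp_tendsto_zero (p : ℝ) (hp : 1 < p) : Tendsto (sinhp p) (𝓝[>] 0) (𝓝[>] 0) := by
  apply tendsto_nhdsWithin_iff.2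
  constructor
  · have he : Tendsto (fun x : ℝ => Real.exp x - 1) (𝓝[>] 0) (𝓝 0) := by
      have : Continuous (fun x : ℝ => Real.exp x - 1) := by fun_prop
      have := this.tendsto 0
      simp at this
      exact this.mono_left nhdsWithin_le_nhds
    apply tendsto_of_tendsto_of_tendsto_of_le_of_le' tendsto_const_nhds he
    · filter_upwards [self_mem_nhdsWithin] with x hx
      exact sinhp_nonneg p hp x (le_of_lt hx)
    · filter_upwards [self_mem_nhdsWithin] with x hx
      have hx : 0 < x := hx
      have hs := sinhp_pos p hp x hx
      have := arsinhp_ge_log p hp _ hs.le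
      rw [arsinhp_sinhp p hp x hx.le, Real.log_le_iff_le_exp (by linarith)] at this
      linarith
  · filter_upwards [self_mem_nhdsWithin] with x hx using sinhp_pos p hp x hx

theorem stmt4 (p : ℝ) (hp : 1 < p) :
    StrictMonoOn (fun x => Real.log (sinhp p x / x) / Real.log (coshp p x))
      (Set.Ioi 0) ∧
    Tendsto (fun x => Real.log (sinhp p x / x) / Real.log (coshp p x))
      (𝓝[>] 0) (𝓝 (1 / (1 + p))) ∧
    Tendsto (fun x => Real.log (sinhp p x / x) / Real.log (coshp p x))
      atTop (𝓝 1) ∧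
    (∀ x > (0:ℝ),
      coshp p x ^ (1 / (1 + p)) < sinhp p x / x ∧ sinhp p x / x < coshp p x ^ (1:ℝ)) ∧
    (∀ α : ℝ, (∀ x > (0:ℝ), coshp p x ^ α < sinhp p x / x) → α ≤ 1 / (1 + p)) ∧
    (∀ β : ℝ, (∀ x > (0:ℝ), sinhp p x / x < coshp p x ^ β) → 1 ≤ β) := by
  have hfg : ∀ x > 0, Real.log (sinhp p x / x) / Real.log (coshp p x) = auxG p (sinhp p x) := by
    intro x hx
    have hx' : 0 ≤ x := le_of_lt hx
    unfold auxG
    rw [arsinhp_sinhp p hp x hx']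
    rfl
  have hC : ∀ x > 0, 1 < coshp p x := fun x hx => auxC_one_lt p hp _ (sinhp_pos p hp x hx)
  have hq : ∀ x > 0, 0 < sinhp p x / x := fun x hx => div_pos (sinhp_pos p hp x hx) hx
  have hmono : StrictMonoOn (fun x => Real.log (sinhp p x / x) / Real.log (coshp p x))
      (Set.Ioi 0) := by
    intro a ha b hb hab
    have ha' : 0 < a := ha
    have hb' : 0 < b := hb
    simp only [hfg a ha', hfg b hb']
    exact auxG_mono p hp (sinhp_pos p hp a ha') (sinhp_pos p hp b hb') (sinhp_mono p hp ha hb hab)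
  have hzero : Tendsto (fun x => Real.log (sinhp p x / x) / Real.log (coshp p x))
      (𝓝[>] 0) (𝓝 (1 / (1 + p))) := by
    apply ((auxG_tendsto_zero p hp).comp (sinhp_tendsto_zero p hp)).congr'
    filter_upwards [self_mem_nhdsWithin] with x hx using (hfg x hx).symm
  have htop : Tendsto (fun x => Real.log (sinhp p x / x) / Real.log (coshp p x))
      atTop (𝓝 1) := by
    apply ((auxG_tendsto_top p hp).comp (sinhp_tendsto_top p hp)).congr'
    filter_upwards [eventually_gt_atTop 0] with x hx using (hfg x hx).symm
  refine ⟨hmono, hzero, htop, ?_, ?_, ?_⟩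
  · intro x hx
    have hC0 : 0 < coshp p x := by linarith [hC x hx]
    constructor
    · have hx2 : 0 < x / 2 := by linarith
      have hle : 1 / (1 + p) ≤ Real.log (sinhp p (x/2) / (x/2)) / Real.log (coshp p (x/2)) := by
        apply le_of_tendsto hzero
        filter_upwards [Ioo_mem_nhdsGT hx2] with y hy
        exact hmono.monotoneOn hy.1 hx2 hy.2.le
      have hlt := hmono (a := x/2) (b := x) hx2 hx (by linarith)
      have h := hle.trans_lt hlt
      rw [lt_div_iff₀ (Real.log_pos (hC x hx)), ← Real.log_rpow hC0] at h
      exact (Real.log_lt_log_iff (by positivity) (hq x hx)).1 h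
    · rw [Real.rpow_one]
      have := auxG_lt_one p hp _ (sinhp_pos p hp x hx)
      rwa [arsinhp_sinhp p hp x (le_of_lt hx)] at this
  · intro α h
    apply ge_of_tendsto hzero
    filter_upwards [self_mem_nhdsWithin] with x hx
    have hC0 : 0 < coshp p x := by linarith [hC x hx]
    rw [le_div_iff₀ (Real.log_pos (hC x hx)), ← Real.log_rpow hC0]
    exact Real.log_le_log (by positivity) (h x hx).le
  · intro β h
    apply le_of_tendsto htop
    filter_upwards [eventually_gt_atTop 0] with x hx
    have hC0 : 0 < coshp p x := by linarith [hC x hx]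
    rw [div_le_iff₀ (Real.log_pos (hC x hx)), ← Real.log_rpow hC0]
    exact Real.log_le_log (hq x hx) (h x hx).le
end

section
/- Let p ≥ 2. Then for all x ∈ (0, π_p/2), sinh_p(x)/x < 3/(2 + cos_p(x)). -/
open Real Set Filter Topology

lemma inv_props (f f' g : ℝ → ℝ) (b L : ℝ) (hf0 : f 0 = 0) (hb : 0 < b)
    (hc : ContinuousOn f (Ico 0 b))
    (hd : ∀ y ∈ Ioo 0 b, HasDerivAt f (f' y) y) (hpos : ∀ y ∈ Ioo 0 b, 0 < f' y)
    (hg : ∀ x ∈ Ico 0 L, g x ∈ Ico 0 b ∧ f (g x) = x) (hL : 0 < L) :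
    StrictMonoOn f (Ico 0 b) ∧ g 0 = 0 ∧ ContinuousOn g (Ico 0 L) ∧
      ∀ x ∈ Ioo 0 L, 0 < g x ∧ HasDerivAt g (f' (g x))⁻¹ x := by
  have hm : StrictMonoOn f (Ico 0 b) := by
    apply strictMonoOn_of_deriv_pos (convex_Ico 0 b) hc
    intro y hy
    rw [interior_Ico] at hy
    rw [(hd y hy).deriv]; exact hpos y hy
  have h0b : (0:ℝ) ∈ Ico 0 b := ⟨le_rfl, hb⟩
  have h0L : (0:ℝ) ∈ Ico 0 L := ⟨le_rfl, hL⟩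
  have hg0 : g 0 = 0 := hm.injOn (hg 0 h0L).1 h0b (by rw [(hg 0 h0L).2, hf0])
  have hgm : StrictMonoOn g (Ico 0 L) := by
    intro x hx y hy hxy
    rw [← hm.lt_iff_lt (hg x hx).1 (hg y hy).1, (hg x hx).2, (hg y hy).2]; exact hxy
  have hgf : ∀ y ∈ Ico 0 b, f y ∈ Ico 0 L → g (f y) = y := fun y hy h =>
    hm.injOn (hg _ h).1 hy (hg _ h).2
  have hgpos : ∀ x ∈ Ioo 0 L, 0 < g x := by
    intro x hx
    rw [← hg0]; exact hgm h0L ⟨hx.1.le, hx.2⟩ hx.1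
  have hca : ∀ x ∈ Ioo 0 L, ContinuousAt g x := by
    intro x hx
    have hx' : x ∈ Ico 0 L := ⟨hx.1.le, hx.2⟩
    apply continuousAt_of_monotoneOn_of_image_mem_nhds hgm.monotoneOn (Ico_mem_nhds hx.1 hx.2)
    have hy : g x ∈ Ioo 0 b := ⟨hgpos x hx, (hg x hx').1.2⟩
    have hfc : ContinuousAt f (g x) := (hd _ hy).continuousAt
    have hn : Ioo 0 L ∈ 𝓝 (f (g x)) := by rw [(hg x hx').2]; exact Ioo_mem_nhds hx.1 hx.2
    filter_upwards [hfc hn, Ioo_mem_nhds hy.1 hy.2] with y h1 h2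
    exact ⟨f y, ⟨h1.1.le, h1.2⟩, hgf y ⟨h2.1.le, h2.2⟩ ⟨h1.1.le, h1.2⟩⟩
  refine ⟨hm, hg0, ?_, ?_⟩
  · intro x hx
    rcases hx.1.eq_or_lt with h | h
    · subst h
      have : ContinuousWithinAt g (Ici 0) 0 := by
        apply continuousWithinAt_right_of_monotoneOn_of_image_mem_nhdsWithin hgm.monotoneOn
          (Ico_mem_nhdsGE hL)
        rw [hg0]
        have hfc : ContinuousWithinAt f (Ico 0 b) 0 := hc 0 h0b
        have hn : Iio L ∈ 𝓝 (f 0) := by rw [hf0]; exact Iio_mem_nhds hL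
        have h3 := hfc hn
        rw [mem_map, nhdsWithin_Ico_eq_nhdsGE hb] at h3
        filter_upwards [h3, Ico_mem_nhdsGE hb] with y h1 h2
        have h4 : f y ∈ Ico 0 L := ⟨by rw [← hf0]; exact hm.monotoneOn h0b h2 h2.1, h1⟩
        exact ⟨f y, h4, hgf y h2 h4⟩
      exact this.mono Ico_subset_Ici_self
    · exact (hca x ⟨h, hx.2⟩).continuousWithinAt
  · intro x hx
    have hx' : x ∈ Ico 0 L := ⟨hx.1.le, hx.2⟩
    have hy : g x ∈ Ioo 0 b := ⟨hgpos x hx, (hg x hx').1.2⟩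
    refine ⟨hgpos x hx, ?_⟩
    apply HasDerivAt.of_local_left_inverse (hca x hx) (hd _ hy) (hpos _ hy).ne'
    filter_upwards [Ioo_mem_nhds hx.1 hx.2] with z hz
    exact (hg z ⟨hz.1.le, hz.2⟩).2

lemma core (p L : ℝ) (hp : 2 ≤ p) (s S A : ℝ → ℝ) (hs0 : s 0 = 0) (hS0 : S 0 = 0)
    (hA0 : A 0 = 0) (hAm : StrictMonoOn A (Ico 0 1)) (hAc : ContinuousOn A (Ico 0 1))
    (hA : ∀ y ∈ Ioo (0:ℝ) 1, HasDerivAt A ((1 - y ^ p) ^ (-1 / p)) y)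
    (hAs : ∀ x ∈ Ico 0 L, A (s x) = x)
    (hsc : ContinuousOn s (Ico 0 L)) (hSc : ContinuousOn S (Ico 0 L))
    (hsI : ∀ x ∈ Ico 0 L, s x ∈ Ico (0:ℝ) 1)
    (hSI : ∀ x ∈ Ico 0 L, 0 ≤ S x)
    (hs : ∀ x ∈ Ioo 0 L, 0 < s x ∧ HasDerivAt s ((1 - (s x) ^ p) ^ (1 / p)) x)
    (hS : ∀ x ∈ Ioo 0 L, 0 < S x ∧ HasDerivAt S ((1 + (S x) ^ p) ^ (1 / p)) x) :
    ∀ x ∈ Ioo 0 L, 0 < 3 * x - S x * (2 + (1 - (s x) ^ p) ^ (1 / p)) := by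
  have hp0 : 0 < p := by linarith
  obtain ⟨c, hcdef⟩ : ∃ c : ℝ → ℝ, c = fun x => (1 - (s x) ^ p) ^ (1 / p) := ⟨_, rfl⟩
  obtain ⟨C, hCdef⟩ : ∃ C : ℝ → ℝ, C = fun x => (1 + (S x) ^ p) ^ (1 / p) := ⟨_, rfl⟩
  have hcx : ∀ x, (1 - (s x) ^ p) ^ (1 / p) = c x := fun x => by rw [hcdef]
  have hCx : ∀ x, (1 + (S x) ^ p) ^ (1 / p) = C x := fun x => by rw [hCdef]
  simp only [hcx, hCx] at hs hS ⊢
  have sub : ∀ x ∈ Ioo 0 L, x ∈ Ico 0 L := fun x hx => ⟨hx.1.le, hx.2⟩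
  have hsp : ∀ x ∈ Ico 0 L, 0 < 1 - (s x) ^ p := fun x hx => by
    have := Real.rpow_lt_one (hsI x hx).1 (hsI x hx).2 hp0
    linarith
  have hSp : ∀ x ∈ Ico 0 L, 0 < 1 + (S x) ^ p := fun x hx => by
    have := Real.rpow_nonneg (hSI x hx) p
    linarith
  have hcpos : ∀ x ∈ Ico 0 L, 0 < c x := fun x hx => by
    rw [← hcx]; exact Real.rpow_pos_of_pos (hsp x hx) _
  have hCpos : ∀ x ∈ Ico 0 L, 0 < C x := fun x hx => by
    rw [← hCx]; exact Real.rpow_pos_of_pos (hSp x hx) _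
  have hcle : ∀ x ∈ Ico 0 L, c x ≤ 1 := fun x hx => by
    rw [← hcx]
    apply Real.rpow_le_one (hsp x hx).le _ (by positivity)
    have := Real.rpow_nonneg (hsI x hx).1 p
    linarith
  have hCp : ∀ x ∈ Ico 0 L, C x ^ p = 1 + S x ^ p := fun x hx => by
    rw [← hCx, ← Real.rpow_mul (hSp x hx).le, one_div_mul_cancel hp0.ne', Real.rpow_one]
  have hcc : ContinuousOn c (Ico 0 L) := by
    rw [hcdef]
    refine ContinuousOn.rpow_const ?_ (fun x hx => Or.inl (hsp x hx).ne')
    exact continuousOn_const.sub (hsc.rpow_const fun x hx => Or.inr hp0.le)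
  have hCc : ContinuousOn C (Ico 0 L) := by
    rw [hCdef]
    refine ContinuousOn.rpow_const ?_ (fun x hx => Or.inl (hSp x hx).ne')
    exact continuousOn_const.add (hSc.rpow_const fun x hx => Or.inr hp0.le)
  have hcd : ∀ x ∈ Ioo 0 L, HasDerivAt c (-(s x ^ (p - 1) * c x ^ (2 - p))) x := by
    intro x hx
    have h1 := (((hs x hx).2.rpow_const (p := p) (Or.inl (hs x hx).1.ne')).const_sub 1).rpow_const
      (p := 1 / p) (Or.inl (hsp x (sub x hx)).ne')
    have e1 : (1 - s x ^ p) ^ (1 / p - 1) = c x ^ (1 - p) := by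
      rw [← hcx, ← Real.rpow_mul (hsp x (sub x hx)).le]; congr 1; field_simp
    have e2 : c x ^ (2 - p) = c x * c x ^ (1 - p) := by
      rw [show (2 - p) = 1 + (1 - p) by ring, Real.rpow_add (hcpos x (sub x hx)), Real.rpow_one]
    rw [e1] at h1
    rw [e2, hcdef]
    refine h1.congr_deriv ?_
    simp only [hcx]
    field_simp
  have hCd : ∀ x ∈ Ioo 0 L, HasDerivAt C (S x ^ (p - 1) * C x ^ (2 - p)) x := by
    intro x hx
    have h1 := (((hS x hx).2.rpow_const (p := p) (Or.inl (hS x hx).1.ne')).const_add 1).rpow_const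
      (p := 1 / p) (Or.inl (hSp x (sub x hx)).ne')
    have e1 : (1 + S x ^ p) ^ (1 / p - 1) = C x ^ (1 - p) := by
      rw [← hCx, ← Real.rpow_mul (hSp x (sub x hx)).le]; congr 1; field_simp
    have e2 : C x ^ (2 - p) = C x * C x ^ (1 - p) := by
      rw [show (2 - p) = 1 + (1 - p) by ring, Real.rpow_add (hCpos x (sub x hx)), Real.rpow_one]
    rw [e1] at h1
    rw [e2, hCdef]
    refine h1.congr_deriv ?_
    simp only [hCx]
    field_simp
  -- tanh < sin
  have hTI : ∀ x ∈ Ico 0 L, S x / C x ∈ Ico (0:ℝ) 1 := by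
    intro x hx
    refine ⟨div_nonneg (hSI x hx) (hCpos x hx).le, ?_⟩
    rw [div_lt_one (hCpos x hx), ← Real.rpow_lt_rpow_iff (hSI x hx) (hCpos x hx).le hp0, hCp x hx]
    linarith
  have hTd : ∀ x ∈ Ioo 0 L, HasDerivAt (fun x => S x / C x) (1 - (S x / C x) ^ p) x := by
    intro x hx
    have hC := hCpos x (sub x hx)
    refine ((hS x hx).2.div (hCd x hx) hC.ne').congr_deriv ?_
    rw [Real.div_rpow (hS x hx).1.le hC.le]
    have e1 : S x ^ p = S x * S x ^ (p - 1) := by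
      conv_lhs => rw [show p = 1 + (p - 1) by ring, Real.rpow_add (hS x hx).1, Real.rpow_one]
    have e2 : C x ^ (2 - p) = C x ^ 2 / C x ^ p := by
      rw [Real.rpow_sub hC, Real.rpow_two]
    have := Real.rpow_pos_of_pos hC p
    rw [e1, e2]
    field_simp
  have hTs : ∀ x ∈ Ioo 0 L, S x / C x < s x := by
    have hmono : StrictMonoOn (fun x => x - A (S x / C x)) (Ico 0 L) := by
      apply strictMonoOn_of_deriv_pos (convex_Ico 0 L)
      · apply continuousOn_id.sub
        exact hAc.comp (hSc.div hCc fun x hx => (hCpos x hx).ne') hTI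
      · intro x hx
        rw [interior_Ico] at hx
        have hT := hTI x (sub x hx)
        have hT0 : 0 < S x / C x := div_pos (hS x hx).1 (hCpos x (sub x hx))
        have h1 := (hasDerivAt_id x).sub ((hA _ ⟨hT0, hT.2⟩).comp x (hTd x hx))
        have h2 : deriv (fun x => x - A (S x / C x)) x = _ := h1.deriv
        rw [h2]
        have hb : 0 < 1 - (S x / C x) ^ p := by
          have := Real.rpow_lt_one hT.1 hT.2 hp0
          linarith
        have hb1 : 1 - (S x / C x) ^ p < 1 := by
          have := Real.rpow_pos_of_pos hT0 p
          linarith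
        have : (1 - (S x / C x) ^ p) ^ (-1 / p) * (1 - (S x / C x) ^ p) < 1 := by
          rw [← Real.rpow_add_one hb.ne']
          apply Real.rpow_lt_one hb.le hb1
          have : 1 / p < 1 := by rw [div_lt_one hp0]; linarith
          rw [neg_div]; linarith
        linarith
    intro x hx
    have hL : 0 < L := hx.1.trans hx.2
    have h := hmono ⟨le_rfl, hL⟩ (sub x hx) hx.1
    simp only [hS0, zero_div, hA0, sub_zero] at h
    rw [← hAm.lt_iff_lt (hTI x (sub x hx)) (hsI x (sub x hx)), hAs x (sub x hx)]
    linarith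
  -- derivatives
  have hFd : ∀ x ∈ Ioo 0 L, HasDerivAt (fun x => 3 * x - S x * (2 + c x))
      (3 - C x * (2 + c x) + S x * (c x ^ (2 - p) * s x ^ (p - 1))) x := by
    intro x hx
    refine (((hasDerivAt_id x).const_mul 3).sub
      ((hS x hx).2.mul ((hcd x hx).const_add 2))).congr_deriv ?_
    ring
  have hGm : StrictMonoOn
      (fun x => 3 - C x * (2 + c x) + S x * (c x ^ (2 - p) * s x ^ (p - 1))) (Ico 0 L) := by
    apply strictMonoOn_of_deriv_pos (convex_Ico 0 L)
    · apply ContinuousOn.add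
      · exact continuousOn_const.sub (hCc.mul (continuousOn_const.add hcc))
      · apply hSc.mul
        apply (hcc.rpow_const fun x hx => Or.inl (hcpos x hx).ne').mul
        exact hsc.rpow_const fun x hx => Or.inr (by linarith)
    · intro x hx
      rw [interior_Ico] at hx
      have hx' := sub x hx
      have hC := hCpos x hx'
      have hc := hcpos x hx'
      have hSx := (hS x hx).1
      have hsx := (hs x hx).1
      have hT0 : 0 < S x / C x := div_pos hSx hC
      have h1 := (((hCd x hx).mul ((hcd x hx).const_add 2)).const_sub 3).add
        ((hS x hx).2.mul (((hcd x hx).rpow_const (p := 2 - p) (Or.inl hc.ne')).mul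
          ((hs x hx).2.rpow_const (p := p - 1) (Or.inl hsx.ne'))))
      have h2 : deriv (fun x => 3 - C x * (2 + c x) + S x * (c x ^ (2 - p) * s x ^ (p - 1))) x
        = _ := h1.deriv
      rw [h2]
      have hk : 1 ≤ c x ^ (2 - p) :=
        Real.one_le_rpow_of_pos_of_le_one_of_nonpos hc (hcle x hx') (by linarith)
      have e1 : S x ^ (p - 1) * C x ^ (2 - p) = C x * (S x / C x) ^ (p - 1) := by
        rw [Real.div_rpow hSx.le hC.le, show 2 - p = 1 - (p - 1) by ring, Real.rpow_sub hC,
          Real.rpow_one]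
        ring
      have e2 : (S x / C x) ^ (p - 1) = (S x / C x) * (S x / C x) ^ (p - 1 - 1) := by
        conv_lhs => rw [show p - 1 = 1 + (p - 1 - 1) by ring, Real.rpow_add hT0, Real.rpow_one]
      have l1 : (S x / C x) ^ (p - 1) < s x ^ (p - 1) :=
        Real.rpow_lt_rpow hT0.le (hTs x hx) (by linarith)
      have l2 : (S x / C x) ^ (p - 1 - 1) ≤ s x ^ (p - 1 - 1) :=
        Real.rpow_le_rpow hT0.le (hTs x hx).le (by linarith)
      have l3 : s x ^ (p - 1) ≤ c x ^ (2 - p) * s x ^ (p - 1) :=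
        le_mul_of_one_le_left (Real.rpow_nonneg hsx.le _) hk
      have n1 : 0 ≤ -(s x ^ (p - 1) * c x ^ (2 - p)) * (2 - p) * c x ^ (2 - p - 1)
          * s x ^ (p - 1) := by
        have : 0 ≤ p - 2 := by linarith
        have : 0 ≤ (s x ^ (p - 1) * c x ^ (2 - p)) * (p - 2) * c x ^ (2 - p - 1)
          * s x ^ (p - 1) := by positivity
        linarith
      have n2 : c x * (S x / C x) ^ (p - 1 - 1) ≤
          c x ^ (2 - p) * (c x * (p - 1) * s x ^ (p - 1 - 1)) := by
        calc c x * (S x / C x) ^ (p - 1 - 1) ≤ c x * s x ^ (p - 1 - 1) := by gcongr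
          _ = 1 * (c x * 1 * s x ^ (p - 1 - 1)) := by ring
          _ ≤ _ := by gcongr; linarith
      have n3 : C x * ((S x / C x) ^ (p - 1) * c x) ≤
          S x * (-(s x ^ (p - 1) * c x ^ (2 - p)) * (2 - p) * c x ^ (2 - p - 1)
          * s x ^ (p - 1) + c x ^ (2 - p) * (c x * (p - 1) * s x ^ (p - 1 - 1))) := by
        have : C x * ((S x / C x) ^ (p - 1) * c x) = S x * (c x * (S x / C x) ^ (p - 1 - 1)) := by
          rw [e2]; field_simp
        rw [this]
        apply mul_le_mul_of_nonneg_left _ hSx.le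
        linarith
      have n4 : C x * (S x / C x) ^ (p - 1) < C x * (c x ^ (2 - p) * s x ^ (p - 1)) :=
        mul_lt_mul_of_pos_left (l1.trans_le l3) hC
      rw [e1, Pi.mul_apply]
      linarith [n3, n4]
  have hFm : StrictMonoOn (fun x => 3 * x - S x * (2 + c x)) (Ico 0 L) := by
    apply strictMonoOn_of_deriv_pos (convex_Ico 0 L)
    · exact (continuousOn_const.mul continuousOn_id).sub (hSc.mul (continuousOn_const.add hcc))
    · intro x hx
      rw [interior_Ico] at hx
      rw [(hFd x hx).deriv]
      have hL : 0 < L := hx.1.trans hx.2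
      have h := hGm ⟨le_rfl, hL⟩ (sub x hx) hx.1
      have c0 : c 0 = 1 := by rw [← hcx, hs0, Real.zero_rpow hp0.ne']; simp
      have C0 : C 0 = 1 := by rw [← hCx, hS0, Real.zero_rpow hp0.ne']; simp
      simp only [c0, C0, hS0] at h
      linarith
  intro x hx
  have hL : 0 < L := hx.1.trans hx.2
  have h := hFm ⟨le_rfl, hL⟩ (sub x hx) hx.1
  simp only [hS0] at h
  linarith

lemma arsinh_cont (p : ℝ) (hp : 2 ≤ p) :
    ContinuousOn (fun t : ℝ => (1 + t ^ p) ^ (-1 / p)) (Ici 0) := by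
  refine ContinuousOn.rpow_const ?_ (fun t ht => Or.inl ?_)
  · exact continuousOn_const.add (continuousOn_id.rpow_const fun x hx => Or.inr (by linarith))
  · have := Real.rpow_nonneg (mem_Ici.1 ht) p
    positivity

lemma arsinh_ii (p : ℝ) (hp : 2 ≤ p) (y : ℝ) (hy : 0 ≤ y) :
    IntervalIntegrable (fun t : ℝ => (1 + t ^ p) ^ (-1 / p)) MeasureTheory.volume 0 y := by
  apply ContinuousOn.intervalIntegrable
  rw [uIcc_of_le hy]
  exact (arsinh_cont p hp).mono Icc_subset_Ici_self

lemma arsinh_lower (p : ℝ) (hp : 2 ≤ p) (y : ℝ) (hy : 0 ≤ y) :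
    Real.log (1 + y) ≤ arsinhp p y := by
  have hi : ∫ t in (0:ℝ)..y, (1 + t)⁻¹ = Real.log (1 + y) := by
    have := intervalIntegral.integral_comp_add_left (f := fun t : ℝ => t⁻¹) (a := 0) (b := y) 1
    rw [this, integral_inv_of_pos (by norm_num) (by linarith)]
    simp
  rw [← hi]
  apply intervalIntegral.integral_mono_on hy _ (arsinh_ii p hp y hy)
  · intro t ht
    have h1 : 1 + t ^ p ≤ (1 + t) ^ p := by
      have := Real.add_rpow_le_rpow_add (a := 1) (b := t) zero_le_one ht.1 (p := p) (by linarith)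
      simpa using this
    have h0 : 0 < 1 + t ^ p := by
      have := Real.rpow_nonneg ht.1 p
      linarith
    have h2 := Real.rpow_le_rpow_of_nonpos h0 h1 (z := -1 / p)
      (div_nonpos_of_nonpos_of_nonneg (by norm_num) (by linarith))
    rw [← Real.rpow_mul (by linarith [ht.1]), mul_div_cancel₀ _ (by linarith : p ≠ 0),
      Real.rpow_neg_one] at h2
    exact h2
  · apply ContinuousOn.intervalIntegrable
    rw [uIcc_of_le hy]
    refine ContinuousOn.inv₀ (by fun_prop) (fun t ht => ?_)
    linarith [ht.1]

theorem stmt14 (p : ℝ) (hp : 2 ≤ p) :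
    ∀ x ∈ Set.Ioo 0 (pip p / 2), sinhp p x / x < 3 / (2 + cosp p x) := by
  have hp0 : 0 < p := by linarith
  have hpip : pip p / 2 = arcsinp p 1 := by unfold pip; ring
  rw [hpip]
  by_cases hinteg : IntervalIntegrable (fun t : ℝ => (1 - t ^ p) ^ (-1 / p)) MeasureTheory.volume 0 1
  swap
  · intro x hx
    have : arcsinp p 1 = 0 := intervalIntegral.integral_undef hinteg
    rw [this] at hx
    exact absurd (hx.1.trans hx.2) (lt_irrefl _)
  intro x₀ hx₀
  obtain ⟨L, hLdef⟩ : ∃ L, L = arcsinp p 1 := ⟨_, rfl⟩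
  rw [← hLdef] at hx₀
  have hL : 0 < L := hx₀.1.trans hx₀.2
  have A0 : arcsinp p 0 = 0 := intervalIntegral.integral_same
  have H0 : arsinhp p 0 = 0 := intervalIntegral.integral_same
  have hAc : ContinuousOn (arcsinp p) (Icc 0 1) := by
    have := intervalIntegral.continuousOn_primitive_interval'
      (f := fun t : ℝ => (1 - t ^ p) ^ (-1 / p)) (a := 0) hinteg (by simp)
    rw [uIcc_of_le zero_le_one] at this
    exact this
  have hpow : ∀ y ∈ Ioo (0:ℝ) 1, 0 < 1 - y ^ p := fun y hy => by
    have := Real.rpow_lt_one hy.1.le hy.2 hp0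
    linarith
  have hAd : ∀ y ∈ Ioo (0:ℝ) 1, HasDerivAt (arcsinp p) ((1 - y ^ p) ^ (-1 / p)) y := by
    intro y hy
    have hco : ContinuousOn (fun t : ℝ => (1 - t ^ p) ^ (-1 / p)) (Ioo 0 1) := by
      refine ContinuousOn.rpow_const ?_ (fun t ht => Or.inl (hpow t ht).ne')
      exact continuousOn_const.sub (continuousOn_id.rpow_const fun x hx => Or.inr (by linarith))
    apply intervalIntegral.integral_hasDerivAt_right
    · apply hinteg.mono_set
      rw [uIcc_of_le zero_le_one, uIcc_of_le hy.1.le]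
      exact Icc_subset_Icc_right hy.2.le
    · exact hco.stronglyMeasurableAtFilter isOpen_Ioo y hy
    · exact hco.continuousAt (Ioo_mem_nhds hy.1 hy.2)
  have hs : ∀ x ∈ Ico 0 L, sinp p x ∈ Ico (0:ℝ) 1 ∧ arcsinp p (sinp p x) = x := by
    intro x hx
    have hex : ∃ a ∈ Icc (0:ℝ) 1, arcsinp p a = x := by
      have := intermediate_value_Icc zero_le_one hAc
      exact this ⟨by rw [A0]; exact hx.1, by rw [← hLdef]; exact hx.2.le⟩
    have h1 : sinp p x ∈ Icc (0:ℝ) 1 := Function.invFunOn_mem hex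
    have h2 : arcsinp p (sinp p x) = x := Function.invFunOn_eq hex
    refine ⟨⟨h1.1, lt_of_le_of_ne h1.2 fun h => ?_⟩, h2⟩
    rw [h, ← hLdef] at h2
    exact hx.2.ne h2.symm
  obtain ⟨hAm, hs0, hsc, hsd⟩ := inv_props (arcsinp p) (fun y => (1 - y ^ p) ^ (-1 / p)) (sinp p)
    1 L A0 one_pos (hAc.mono Ico_subset_Icc_self) hAd
    (fun y hy => Real.rpow_pos_of_pos (hpow y hy) _) hs hL
  -- hyperbolic
  have hHpos : ∀ y : ℝ, 0 ≤ y → 0 < 1 + y ^ p := fun y hy => by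
    have := Real.rpow_nonneg hy p
    linarith
  have hHd : ∀ y : ℝ, 0 < y → HasDerivAt (arsinhp p) ((1 + y ^ p) ^ (-1 / p)) y := by
    intro y hy
    have hco := (arsinh_cont p hp).mono Ioi_subset_Ici_self
    apply intervalIntegral.integral_hasDerivAt_right (arsinh_ii p hp y hy.le)
    · exact hco.stronglyMeasurableAtFilter isOpen_Ioi y hy
    · exact hco.continuousAt (Ioi_mem_nhds hy)
  have hHc : ∀ M : ℝ, 0 ≤ M → ContinuousOn (arsinhp p) (Icc 0 M) := by
    intro M hM
    have := intervalIntegral.continuousOn_primitive_interval'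
      (f := fun t : ℝ => (1 + t ^ p) ^ (-1 / p)) (a := 0) (arsinh_ii p hp M hM) (by simp)
    rw [uIcc_of_le hM] at this
    exact this
  have hHmono : MonotoneOn (arsinhp p) (Ici 0) := by
    intro a ha b hb hab
    rcases hab.eq_or_lt with h | h
    · rw [h]
    have hm : StrictMonoOn (arsinhp p) (Icc 0 b) := by
      apply strictMonoOn_of_deriv_pos (convex_Icc 0 b) (hHc b hb)
      intro y hy
      rw [interior_Icc] at hy
      rw [(hHd y hy.1).deriv]; exact Real.rpow_pos_of_pos (hHpos y hy.1.le) _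
    exact hm.monotoneOn ⟨ha, hab⟩ ⟨hb, le_rfl⟩ hab
  obtain ⟨M, hM⟩ : ∃ M, M = Real.exp L := ⟨_, rfl⟩
  have hM0 : 0 < M := by rw [hM]; exact Real.exp_pos L
  have hML : L ≤ arsinhp p M := by
    refine le_trans ?_ (arsinh_lower p hp M hM0.le)
    rw [Real.le_log_iff_exp_le (by linarith), ← hM]
    linarith
  have hS : ∀ x ∈ Ico 0 L, sinhp p x ∈ Ico (0:ℝ) M ∧ arsinhp p (sinhp p x) = x := by
    intro x hx
    have hex : ∃ a ∈ Ici (0:ℝ), arsinhp p a = x := by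
      have := intermediate_value_Icc hM0.le (hHc M hM0.le)
      obtain ⟨a, ha, h⟩ := this ⟨by rw [H0]; exact hx.1, hx.2.le.trans hML⟩
      exact ⟨a, ha.1, h⟩
    have h1 : sinhp p x ∈ Ici (0:ℝ) := Function.invFunOn_mem hex
    have h2 : arsinhp p (sinhp p x) = x := Function.invFunOn_eq hex
    refine ⟨⟨h1, ?_⟩, h2⟩
    by_contra! h
    have := hHmono (mem_Ici.2 hM0.le) h1 h
    rw [h2] at this
    linarith [hx.2]
  obtain ⟨-, hS0, hSc, hSd⟩ := inv_props (arsinhp p) (fun y => (1 + y ^ p) ^ (-1 / p)) (sinhp p)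
    M L H0 hM0 ((hHc M hM0.le).mono Ico_subset_Icc_self) (fun y hy => hHd y hy.1)
    (fun y hy => Real.rpow_pos_of_pos (hHpos y hy.1.le) _) hS hL
  have key := core p L hp (sinp p) (sinhp p) (arcsinp p) hs0 hS0 A0 hAm
    (hAc.mono Ico_subset_Icc_self) hAd (fun x hx => (hs x hx).2) hsc hSc (fun x hx => (hs x hx).1)
    (fun x hx => (hS x hx).1.1)
    (fun x hx => by
      refine ⟨(hsd x hx).1, ?_⟩
      convert (hsd x hx).2 using 1
      rw [← Real.rpow_neg (hpow _ ⟨(hsd x hx).1, (hs x ⟨hx.1.le, hx.2⟩).1.2⟩).le]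
      congr 1; ring)
    (fun x hx => by
      refine ⟨(hSd x hx).1, ?_⟩
      convert (hSd x hx).2 using 1
      rw [← Real.rpow_neg (hHpos _ (hSd x hx).1.le).le]
      congr 1; ring) x₀ hx₀
  have hc0 : 0 ≤ cosp p x₀ := by
    apply Real.rpow_nonneg
    exact (hpow _ ⟨(hsd x₀ hx₀).1, (hs x₀ ⟨hx₀.1.le, hx₀.2⟩).1.2⟩).le
  rw [div_lt_div_iff₀ hx₀.1 (by linarith)]
  unfold cosp
  linarith
end
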